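/- arXiv:1411.3995 — 3 statements merged into one kernel-verified Lean document; each statement's English description precedes it below -/
import Mathlib

section
/- If a real X is Martin-Löf BP random and f : ℕ → ℕ is a strictly increasing primitive recursive function, then X does not contain the range of f; that is, there exists some n with X(f(n)) = false. -/
namespace BP



/-- The finite binary string `(X 0, …, X (n−1))`. -/
def take (X : ℕ → Bool) (n : ℕ) : List Bool := (List.range n).map X

/-- `X ∈ [G]`: the real `X` extends some string of the finite set (list) `G`. -/
def Mem (X : ℕ → Bool) (G : List (List Bool)) : Prop :=
  ∃ τ ∈ G, take X τ.length = τ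

/-- The maximum length of a string in `G`. -/
def maxLen (G : List (List Bool)) : ℕ := (G.map List.length).foldr max 0

/-- The list of all binary strings of length `L`. -/
def allStrings (L : ℕ) : List (List Bool) :=
  (List.range (2 ^ L)).map fun k => (List.range L).map fun i => k.testBit i

/-- The uniform (fair-coin) measure of the clopen set `[G]`, computed by counting
which strings of length `maxLen G` extend a member of `G`. -/
def mu (G : List (List Bool)) : ℚ :=
  (((allStrings (maxLen G)).filter fun σ => G.any fun τ => decide (τ <+: σ)).length : ℚ)
    / 2 ^ maxLen G

/-- The uniform measure of `[G] ∩ [τ]`. -/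
def muCap (G : List (List Bool)) (τ : List Bool) : ℚ :=
  (((allStrings (max (maxLen G) τ.length)).filter fun σ =>
      decide (τ <+: σ) && (G.any fun ρ => decide (ρ <+: σ))).length : ℚ)
    / 2 ^ max (maxLen G) τ.length

/-- A primitive recursive test: a primitive recursive sequence of finite sets of
binary strings with `μ([Gₙ]) ≤ 2⁻ⁿ`. -/
def IsTest (G : ℕ → List (List Bool)) : Prop :=
  Primrec G ∧ ∀ n, mu (G n) ≤ ((2 : ℚ) ^ n)⁻¹

/-- `X` is Martin-Löf BP random. -/
def MLBPRandom (X : ℕ → Bool) : Prop :=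
  ∀ G : ℕ → List (List Bool), IsTest G → ∃ n, ¬ Mem X (G n)

/-- A weak primitive recursive test. -/
def IsWeakTest (G : ℕ → List (List Bool)) : Prop :=
  IsTest G ∧ ∃ ℓ : ℕ → ℕ, Primrec ℓ ∧ (∀ n, ∀ τ ∈ G n, τ.length = ℓ n) ∧
    ∀ n, ∀ τ ∈ G n, muCap (G (n + 1)) τ ≤ (1 / 2) * ((2 : ℚ) ^ τ.length)⁻¹

/-- A martingale with values in the nonnegative rationals. -/
def IsMartingale (d : List Bool → ℚ) : Prop :=
  d [] = 1 ∧ (∀ σ, 0 ≤ d σ) ∧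
    ∀ σ, d σ = (d (σ ++ [false]) + d (σ ++ [true])) / 2

/-- The martingale `d` succeeds primitive recursively on `X`. -/
def SucceedsPR (d : List Bool → ℚ) (X : ℕ → Bool) : Prop :=
  ∃ f : ℕ → ℕ, Primrec f ∧ ∀ n, (2 : ℚ) ^ n ≤ d (take X (f n))

/-- `X` is martingale BP random. -/
def MartingaleBPRandom (X : ℕ → Bool) : Prop :=
  ¬ ∃ d : List Bool → ℚ, Primrec d ∧ IsMartingale d ∧ SucceedsPR d X

/-- `X` is primitive recursively compressed by the machine `M`. -/
def CompressedBy (M : List Bool → List Bool) (X : ℕ → Bool) : Prop :=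
  ∃ f : ℕ → ℕ, Primrec f ∧
    ∀ c, ∃ σ : List Bool, σ.length ≤ f c - c ∧ M σ = take X (f c)

/-- `X` is Kolmogorov BP random. -/
def KolmogorovBPRandom (X : ℕ → Bool) : Prop :=
  ¬ ∃ M : List Bool → List Bool, Primrec M ∧ CompressedBy M X

/-- `M` is a (total) process machine: it is extension preserving. -/
def IsProcessMachine (M : List Bool → List Bool) : Prop :=
  ∀ σ τ : List Bool, σ <+: τ → M σ <+: M τ

/-- `M` is a quick process BP machine. -/
def IsQuickProcessBP (M : List Bool → List Bool) : Prop :=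
  Primrec M ∧ IsProcessMachine M ∧
    ∃ h : ℕ → ℕ, Primrec h ∧ Monotone h ∧ (∀ k, ∃ n, k ≤ h n) ∧
      ∀ τ : List Bool, h τ.length ≤ (M τ).length

/-- `X` is quick process BP random. -/
def QuickProcessBPRandom (X : ℕ → Bool) : Prop :=
  ¬ ∃ M : List Bool → List Bool, IsQuickProcessBP M ∧ CompressedBy M X

/-- The number of `i < n` with `X i = true`. -/
def cardBelow (X : ℕ → Bool) (n : ℕ) : ℕ := (List.range n).countP X

/-- The list of the lowest `L` binary digits of `k`. -/
def bits (L k : ℕ) : List Bool := (List.range L).map k.testBit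

theorem length_bits (L k : ℕ) : (bits L k).length = L := by simp [bits]

theorem allStrings_eq_map_bits (L : ℕ) : allStrings L = (List.range (2 ^ L)).map (bits L) := rfl

theorem bits_injOn (L : ℕ) {k l : ℕ} (hk : k < 2 ^ L) (hl : l < 2 ^ L)
    (h : bits L k = bits L l) : k = l := by
  refine Nat.eq_of_testBit_eq fun i => ?_
  rcases lt_or_ge i L with hi | hi
  · exact List.map_inj_left.1 h i (List.mem_range.2 hi)
  · have hle : 2 ^ L ≤ 2 ^ i := Nat.pow_le_pow_right two_pos hi
    rw [Nat.testBit_lt_two_pow (hk.trans_le hle), Nat.testBit_lt_two_pow (hl.trans_le hle)]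

theorem nodup_allStrings (L : ℕ) : (allStrings L).Nodup := by
  rw [allStrings_eq_map_bits]
  exact List.nodup_range.map_on fun k hk l hl h =>
    bits_injOn L (List.mem_range.1 hk) (List.mem_range.1 hl) h

theorem maxLen_of_forall_length_eq {L : ℕ} {G : List (List Bool)} (hG : G ≠ [])
    (h : ∀ τ ∈ G, τ.length = L) : maxLen G = L := by
  induction G with
  | nil => exact absurd rfl hG
  | cons σ G ih =>
    have hσ : σ.length = L := h σ (by simp)
    rcases eq_or_ne G [] with rfl | hne
    · simp [maxLen, hσ]
    · have := ih hne fun τ hτ => h τ (by simp [hτ])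
      simp only [maxLen, List.map_cons, List.foldr_cons] at this ⊢
      rw [this, hσ, max_self]

/-- If all strings of `G` have length `L`, then `μ [G] ≤ |G| / 2 ^ L`. -/
theorem mu_le_length_div {L : ℕ} {G : List (List Bool)} (h : ∀ τ ∈ G, τ.length = L) :
    mu G ≤ (G.length : ℚ) / 2 ^ L := by
  rcases eq_or_ne G [] with rfl | hG
  · simp [mu]
  rw [mu, maxLen_of_forall_length_eq hG h]
  gcongr
  refine (((nodup_allStrings L).filter _).subperm fun σ hσ => ?_).length_le
  obtain ⟨hσ, hτ⟩ := List.mem_filter.1 hσ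
  obtain ⟨τ, hτG, hp⟩ := List.any_eq_true.1 hτ
  obtain ⟨k, -, rfl⟩ := List.mem_map.1 (allStrings_eq_map_bits L ▸ hσ)
  rwa [← (of_decide_eq_true hp).eq_of_length (by rw [h τ hτG, length_bits])]

theorem take_eq_bits_ofBits (X : ℕ → Bool) (L : ℕ) :
    take X L = bits L (Nat.ofBits fun i : Fin L => X i) := by
  refine List.map_inj_left.2 fun i hi => ?_
  rw [Nat.testBit_ofBits_lt _ _ (List.mem_range.1 hi)]

/-- The numbers below `2 ^ L` whose binary digits at `f 0, …, f (n - 1)` are all one. -/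
def onesAt (f : ℕ → ℕ) (L n : ℕ) : List ℕ :=
  (List.range (2 ^ L)).filter fun k => ∀ i < n, k.testBit (f i) = true

theorem mem_onesAt {f : ℕ → ℕ} {L n k : ℕ} :
    k ∈ onesAt f L n ↔ k < 2 ^ L ∧ ∀ i < n, k.testBit (f i) = true := by
  simp [onesAt]

theorem nodup_onesAt (f : ℕ → ℕ) (L n : ℕ) : (onesAt f L n).Nodup :=
  List.nodup_range.filter _

/-- Flipping the digit at `f n` shows that requiring one more digit halves the count. -/
theorem two_mul_length_onesAt_succ_le {f : ℕ → ℕ} (hf : Function.Injective f) {L n : ℕ}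
    (hn : f n < L) : 2 * (onesAt f L (n + 1)).length ≤ (onesAt f L n).length := by
  set flip : ℕ → ℕ := fun k => k ^^^ 2 ^ f n with hflip
  have hnodup : (onesAt f L (n + 1) ++ (onesAt f L (n + 1)).map flip).Nodup := by
    refine (nodup_onesAt f L _).append
      ((nodup_onesAt f L _).map fun a b h => Nat.xor_left_inj.1 h) fun k hk hk' => ?_
    obtain ⟨l, hl, rfl⟩ := List.mem_map.1 hk'
    have h1 := (mem_onesAt.1 hk).2 n n.lt_succ_self
    have h2 := (mem_onesAt.1 hl).2 n n.lt_succ_self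
    simp [hflip, h2] at h1
  have hsub : onesAt f L (n + 1) ++ (onesAt f L (n + 1)).map flip ⊆ onesAt f L n := by
    intro k hk
    rcases List.mem_append.1 hk with hk | hk
    · have := mem_onesAt.1 hk
      exact mem_onesAt.2 ⟨this.1, fun i hi => this.2 i (by lia)⟩
    · obtain ⟨l, hl, rfl⟩ := List.mem_map.1 hk
      obtain ⟨hlt, hones⟩ := mem_onesAt.1 hl
      refine mem_onesAt.2
        ⟨Nat.xor_lt_two_pow hlt (Nat.pow_lt_pow_right one_lt_two hn), fun i hi => ?_⟩
      have hne : f n ≠ f i := fun h => hi.ne' (hf h)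
      simp [hflip, hne, hones i (by lia)]
  have := (hnodup.subperm hsub).length_le
  simp only [List.length_append, List.length_map] at this
  lia

theorem two_pow_mul_length_onesAt_le {f : ℕ → ℕ} (hf : Function.Injective f) {L n : ℕ}
    (hn : ∀ i < n, f i < L) : 2 ^ n * (onesAt f L n).length ≤ 2 ^ L := by
  induction n with
  | zero => simp [onesAt]
  | succ n ih =>
    calc 2 ^ (n + 1) * (onesAt f L (n + 1)).length
        = 2 ^ n * (2 * (onesAt f L (n + 1)).length) := by ring
      _ ≤ 2 ^ n * (onesAt f L n).length :=
        Nat.mul_le_mul_left _ (two_mul_length_onesAt_succ_le hf (hn n n.lt_succ_self))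
      _ ≤ 2 ^ L := ih fun i hi => hn i (by lia)

theorem primrec₂_pow : Primrec₂ ((· ^ ·) : ℕ → ℕ → ℕ) :=
  Primrec₂.unpaired'.1 Nat.Primrec.pow

theorem primrec₂_testBit : Primrec₂ Nat.testBit := by
  have hdiv : Primrec₂ fun k i : ℕ => k / 2 ^ i % 2 :=
    Primrec.nat_mod.comp
      (Primrec.nat_div.comp Primrec.fst (primrec₂_pow.comp (Primrec.const 2) Primrec.snd))
      (Primrec.const 2)
  refine (Primrec.beq.comp hdiv (Primrec.const 1)).of_eq fun p => ?_
  rw [Nat.testBit_eq_decide_div_mod_eq]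
  rfl

theorem primrec₂_bits : Primrec₂ bits :=
  Primrec.list_map (Primrec.list_range.comp Primrec.fst)
    (primrec₂_testBit.comp (Primrec.snd.comp Primrec.fst) Primrec.snd)

theorem primrec_onesAt {f : ℕ → ℕ} (hf : Primrec f) : Primrec fun n => onesAt f (f n) n := by
  have hbit : PrimrecRel fun i k : ℕ => k.testBit (f i) = true :=
    Primrec.eq.comp (primrec₂_testBit.comp Primrec.snd (hf.comp Primrec.fst)) (Primrec.const true)
  have hall : PrimrecRel fun k n : ℕ => ∀ i < n, k.testBit (f i) = true :=
    hbit.forall_lt.comp Primrec.snd Primrec.fst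
  exact hall.listFilter.comp
    (Primrec.list_range.comp (primrec₂_pow.comp (Primrec.const 2) hf)) Primrec.id

/-- The strings of length `f n` that are one at positions `f 0, …, f (n - 1)` form a test. -/
theorem isTest_onesAt {f : ℕ → ℕ} (hf : Primrec f) (hmono : StrictMono f) :
    IsTest fun n => (onesAt f (f n) n).map (bits (f n)) := by
  refine ⟨Primrec.list_map (primrec_onesAt hf)
    (primrec₂_bits.comp (hf.comp Primrec.fst) Primrec.snd), fun n => ?_⟩
  have hlen : ∀ τ ∈ (onesAt f (f n) n).map (bits (f n)), τ.length = f n := by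
    simp +contextual [length_bits]
  refine (mu_le_length_div hlen).trans ?_
  rw [List.length_map, div_le_iff₀ (by positivity), inv_mul_eq_div, le_div_iff₀' (by positivity)]
  exact_mod_cast two_pow_mul_length_onesAt_le hmono.injective fun i hi => hmono hi

theorem stmt5 (X : ℕ → Bool) (f : ℕ → ℕ) (hX : MLBPRandom X)
    (hf : Primrec f) (hmono : StrictMono f) : ∃ n, X (f n) = false := by
  by_contra! hne
  obtain ⟨n, hn⟩ := hX _ (isTest_onesAt hf hmono)
  refine hn ⟨take X (f n), List.mem_map.2 ⟨Nat.ofBits fun i : Fin (f n) => X i,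
    mem_onesAt.2 ⟨Nat.ofBits_lt_two_pow _, fun i hi => ?_⟩, (take_eq_bits_ofBits X _).symm⟩, ?_⟩
  · rw [Nat.testBit_ofBits_lt _ _ (hmono hi)]
    simpa using hne i
  · simp [take]

end BP
end

section
/- There exists a computable real X : ℕ → Bool which is Martin-Löf BP random. -/
namespace BP



open Nat.Partrec (Code)

/-- Replace every unbounded search in a code by the zero function. -/
def stripSearch (c : Code) : Code :=
  Code.recOn c .zero .succ .left .right (fun _ _ a b => .pair a b) (fun _ _ a b => .comp a b)
    (fun _ _ a b => .prec a b) (fun _ _ => .zero)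

theorem primrec_stripSearch : Primrec stripSearch :=
  Code.primrec_recOn' (α := Code) (σ := Code) .id (.const _) (.const _) (.const _) (.const _)
    (pr := fun _ p => .pair p.2.2.1 p.2.2.2)
    (Code.primrec₂_pair.comp (Primrec.fst.comp <| Primrec.snd.comp <| Primrec.snd.comp .snd)
      (Primrec.snd.comp <| Primrec.snd.comp <| Primrec.snd.comp .snd))
    (co := fun _ p => .comp p.2.2.1 p.2.2.2)
    (Code.primrec₂_comp.comp (Primrec.fst.comp <| Primrec.snd.comp <| Primrec.snd.comp .snd)
      (Primrec.snd.comp <| Primrec.snd.comp <| Primrec.snd.comp .snd))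
    (pc := fun _ p => .prec p.2.2.1 p.2.2.2)
    (Code.primrec₂_prec.comp (Primrec.fst.comp <| Primrec.snd.comp <| Primrec.snd.comp .snd)
      (Primrec.snd.comp <| Primrec.snd.comp <| Primrec.snd.comp .snd))
    (rf := fun _ _ => .zero) (.const _)

theorem eval_stripSearch_dom (c : Code) (n : ℕ) : ((stripSearch c).eval n).Dom := by
  induction c generalizing n with
  | zero => trivial
  | succ => trivial
  | left => trivial
  | right => trivial
  | pair a b ha hb =>
    change ((Code.pair (stripSearch a) (stripSearch b)).eval n).Dom
    simp [Code.eval, Seq.seq, ha, hb]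
  | comp a b ha hb =>
    change ((Code.comp (stripSearch a) (stripSearch b)).eval n).Dom
    exact ⟨hb n, ha _⟩
  | prec a b ha hb =>
    change ((Code.prec (stripSearch a) (stripSearch b)).eval n).Dom
    obtain ⟨x, y, rfl⟩ : ∃ x y, n = Nat.pair x y := ⟨n.unpair.1, n.unpair.2, by simp⟩
    induction y with
    | zero => rw [Code.eval_prec_zero]; exact ha x
    | succ y ih => rw [Code.eval_prec_succ]; exact ⟨ih, hb _⟩
  | rfind' a _ => trivial

/-- The function computed by a code with its unbounded searches removed. -/
def evalStrip (c : Code) (n : ℕ) : ℕ := ((stripSearch c).eval n).get (eval_stripSearch_dom c n)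

theorem computable_evalStrip : Computable₂ evalStrip :=
  (Code.eval_part.comp (primrec_stripSearch.to_comp.comp .fst) .snd).of_eq fun _ =>
    (Part.some_get _).symm

theorem exists_evalStrip_eq {f : ℕ → ℕ} (hf : Nat.Primrec f) : ∃ c, evalStrip c = f := by
  suffices ∃ c, ∀ n, (stripSearch c).eval n = Part.some (f n) by
    obtain ⟨c, hc⟩ := this
    exact ⟨c, funext fun n => by simp [evalStrip, hc]⟩
  induction hf with
  | zero => exact ⟨.zero, fun _ => rfl⟩
  | succ => exact ⟨.succ, fun _ => rfl⟩
  | left => exact ⟨.left, fun _ => rfl⟩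
  | right => exact ⟨.right, fun _ => rfl⟩
  | pair _ _ ha hb =>
    obtain ⟨a, ha⟩ := ha
    obtain ⟨b, hb⟩ := hb
    refine ⟨.pair a b, fun n => ?_⟩
    change (Code.pair (stripSearch a) (stripSearch b)).eval n = _
    simp [Code.eval, Seq.seq, ha, hb]
  | comp _ _ ha hb =>
    obtain ⟨a, ha⟩ := ha
    obtain ⟨b, hb⟩ := hb
    refine ⟨.comp a b, fun n => ?_⟩
    change (Code.comp (stripSearch a) (stripSearch b)).eval n = _
    exact (congrArg (· >>= (stripSearch a).eval) (hb n)).trans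
      ((Part.bind_some _ _).trans (ha _))
  | prec _ _ ha hb =>
    obtain ⟨a, ha⟩ := ha
    obtain ⟨b, hb⟩ := hb
    refine ⟨.prec a b, fun n => ?_⟩
    change (Code.prec (stripSearch a) (stripSearch b)).eval n = _
    obtain ⟨x, y, rfl⟩ : ∃ x y, n = Nat.pair x y := ⟨n.unpair.1, n.unpair.2, by simp⟩
    induction y with
    | zero => rw [Code.eval_prec_zero]; simp [ha]
    | succ y ih => rw [Code.eval_prec_succ, ih]; simp [hb]

/-- A uniformly computable enumeration containing all primitive recursive sequences. -/
def enumSeq {α : Type*} [Primcodable α] [Inhabited α] (e n : ℕ) : α :=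
  ((Encodable.decode (evalStrip (Denumerable.ofNat Code e) n) : Option α)).getD default

theorem computable_enumSeq {α : Type*} [Primcodable α] [Inhabited α] :
    Computable₂ (enumSeq (α := α)) :=
  Primrec.option_getD_default.to_comp.comp <| Computable.decode.comp <|
    computable_evalStrip.comp ((Computable.ofNat Code).comp .fst) .snd

theorem exists_enumSeq_eq {α : Type*} [Primcodable α] [Inhabited α] {f : ℕ → α}
    (hf : Primrec f) : ∃ e, enumSeq e = f := by
  obtain ⟨c, hc⟩ := exists_evalStrip_eq (Primrec.nat_iff.1 (Primrec.encode.comp hf))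
  exact ⟨Encodable.encode c, funext fun n => by simp [enumSeq, hc]⟩

/-- The binary strings of length `n`, by recursion on `n`. -/
def strings (n : ℕ) : List (List Bool) :=
  n.rec [[]] fun _ l => l.flatMap fun s => [false :: s, true :: s]

theorem primrec_strings : Primrec strings :=
  Primrec.nat_rec₁ _ <| Primrec.list_flatMap .snd <|
    Primrec.list_cons.comp (Primrec.list_cons.comp (.const false) .snd) <|
      Primrec.list_cons.comp (Primrec.list_cons.comp (.const true) .snd) (.const [])

theorem mem_strings {n : ℕ} {s : List Bool} : s ∈ strings n ↔ s.length = n := by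
  induction n generalizing s with
  | zero => simp [strings]
  | succ n ih =>
    change s ∈ (strings n).flatMap _ ↔ _
    rcases s with _ | ⟨_ | _, s⟩ <;> simp [ih]

theorem mem_allStrings {n : ℕ} {s : List Bool} : s ∈ allStrings n ↔ s.length = n := by
  constructor
  · intro h
    obtain ⟨k, -, rfl⟩ := List.mem_map.1 h
    simp
  · rintro rfl
    refine List.mem_map.2 ⟨Nat.ofBits fun i : Fin s.length => s[i], ?_, ?_⟩
    · simpa using Nat.ofBits_lt_two_pow _
    · apply List.ext_getElem <;> simp +contextual

theorem primrec_maxLen : Primrec maxLen :=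
  Primrec.list_foldr (Primrec.list_map .id (Primrec.list_length.comp .snd).to₂) (.const 0)
    (Primrec.nat_max.comp (Primrec.fst.comp .snd) (Primrec.snd.comp .snd)).to₂

theorem length_le_maxLen {G : List (List Bool)} {τ : List Bool} (h : τ ∈ G) :
    τ.length ≤ maxLen G := by
  induction G with
  | nil => simp at h
  | cons a G ih =>
    simp only [maxLen, List.map_cons, List.foldr_cons] at ih ⊢
    rcases List.mem_cons.1 h with rfl | h
    · exact le_max_left ..
    · exact (ih h).trans (le_max_right ..)

/-- An extension of `σ` avoiding `[G]`, if one is found, with an additional final bit. -/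
def extend (G : List (List Bool)) (σ : List Bool) : List Bool :=
  ((((strings (maxLen G)).map (σ ++ ·)).filter
    fun s => ∀ τ ∈ G, s.take τ.length ≠ τ).head?.getD σ) ++ [false]

theorem primrec_extend : Primrec₂ extend := by
  have h : PrimrecRel fun (τ s : List Bool) => s.take τ.length ≠ τ :=
    (Primrec.eq.comp (Primrec.list_take.comp (Primrec.list_length.comp .fst) .snd) .fst).not
  have h' : PrimrecRel fun (s : List Bool) (G : List (List Bool)) =>
      ∀ τ ∈ G, s.take τ.length ≠ τ := h.forall_mem_list.swap
  exact Primrec.list_append.comp (Primrec.option_getD.comp (Primrec.list_head?.comp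
    (h'.listFilter.comp (Primrec.list_map (primrec_strings.comp (primrec_maxLen.comp .fst))
      (Primrec.list_append.comp (Primrec.snd.comp .fst) .snd)) .fst)) .snd) (.const [false])

theorem length_lt_and_prefix_extend (G : List (List Bool)) (σ : List Bool) :
    σ.length < (extend G σ).length ∧ σ <+: extend G σ := by
  have : ∃ ρ, extend G σ = (σ ++ ρ) ++ [false] := by
    unfold extend
    rcases h : List.head? _ with _ | s
    · exact ⟨[], by simp⟩
    · have := List.mem_of_mem_head? h
      simp only [List.mem_filter, List.mem_map] at this
      obtain ⟨⟨ρ, -, rfl⟩, -⟩ := this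
      exact ⟨ρ, rfl⟩
  obtain ⟨ρ, h⟩ := this
  rw [h, List.append_assoc]
  exact ⟨by simp, List.prefix_append ..⟩

theorem exists_extension_avoiding {G : List (List Bool)} {σ : List Bool}
    (h : mu G ≤ ((2 : ℚ) ^ (σ.length + 1))⁻¹) :
    ∃ ρ ∈ strings (maxLen G), ∀ τ ∈ G, ¬ τ <+: σ ++ ρ := by
  by_contra! hc
  set M := maxLen G with hM
  set S := (allStrings M).filter fun s => G.any fun τ => decide (τ <+: s) with hS
  have hsub : (allStrings (M - σ.length)).map (σ.take M ++ ·) ⊆ S := by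
    intro s hs
    obtain ⟨ρ, hρ, rfl⟩ := List.mem_map.1 hs
    rw [mem_allStrings] at hρ
    obtain ⟨τ, hτ, hp⟩ := hc (ρ ++ List.replicate (M - ρ.length) false)
      (mem_strings.2 (by simp; omega))
    have hlen : (σ.take M ++ ρ).length = M := by simp; omega
    refine List.mem_filter.2 ⟨mem_allStrings.2 hlen, List.any_eq_true.2 ⟨τ, hτ, ?_⟩⟩
    rw [decide_eq_true_iff]
    refine List.prefix_of_prefix_length_le hp ?_ ((length_le_maxLen hτ).trans hlen.ge)
    rcases le_total M σ.length with hl | hl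
    · have : ρ = [] := List.length_eq_zero_iff.1 (by omega)
      subst this
      simpa using (List.take_prefix M σ).trans (List.prefix_append ..)
    · rw [List.take_of_length_le hl, ← List.append_assoc]
      exact List.prefix_append ..
  have hnd : ((allStrings (M - σ.length)).map (σ.take M ++ ·)).Nodup := by
    refine List.Nodup.map (List.append_right_injective _) ?_
    refine List.Nodup.map_on ?_ List.nodup_range
    intro x hx y hy hxy
    refine Nat.eq_of_testBit_eq fun i => ?_
    rw [List.mem_range] at hx hy
    rcases lt_or_ge i (M - σ.length) with hi | hi
    · simpa [hi] using congrArg (·[i]?) hxy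
    · have := Nat.pow_le_pow_right two_pos hi
      rw [Nat.testBit_lt_two_pow (hx.trans_le this), Nat.testBit_lt_two_pow (hy.trans_le this)]
  have hcard : 2 ^ (M - σ.length) ≤ S.length := by
    simpa [allStrings] using (hnd.subperm hsub).length_le
  have h2 : (S.length : ℚ) / 2 ^ M ≤ ((2 : ℚ) ^ (σ.length + 1))⁻¹ := h
  rw [div_le_iff₀ (by positivity), inv_mul_eq_div, le_div_iff₀ (by positivity)] at h2
  have h3 : S.length * 2 ^ (σ.length + 1) ≤ 2 ^ M := by exact_mod_cast h2
  have h4 : 2 ^ (M - σ.length) * 2 ^ (σ.length + 1) ≤ 2 ^ M :=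
    (Nat.mul_le_mul_right _ hcard).trans h3
  rw [← pow_add, Nat.pow_le_pow_iff_right one_lt_two] at h4
  omega

theorem take_length (X : ℕ → Bool) (n : ℕ) : (take X n).length = n := by simp [take]

theorem take_prefix_take (X : ℕ → Bool) {m n : ℕ} (h : m ≤ n) : take X m <+: take X n := by
  obtain ⟨k, rfl⟩ := Nat.exists_eq_add_of_le h
  simp [take, List.range_add]

theorem not_mem_of_take_extend {X : ℕ → Bool} {G : List (List Bool)} {σ : List Bool}
    (h : mu G ≤ ((2 : ℚ) ^ (σ.length + 1))⁻¹)
    (hX : take X (extend G σ).length = extend G σ) : ¬ Mem X G := by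
  rintro ⟨τ, hτ, hτX⟩
  have hτ' : ∀ s, take X s.length = s → τ.length ≤ s.length → τ <+: s := by
    intro s hs hl
    rw [← hs, ← hτX]
    exact take_prefix_take X (by simpa [take_length] using hl)
  obtain ⟨ρ, hρ, hav⟩ := exists_extension_avoiding h
  have hmem : σ ++ ρ ∈ ((strings (maxLen G)).map (σ ++ ·)).filter
      fun s => ∀ τ ∈ G, s.take τ.length ≠ τ := by
    refine List.mem_filter.2 ⟨List.mem_map.2 ⟨ρ, hρ, rfl⟩, ?_⟩
    rw [decide_eq_true_iff]
    intro τ hτ hp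
    exact hav τ hτ (hp ▸ List.take_prefix ..)
  rcases hh : List.head? (((strings (maxLen G)).map (σ ++ ·)).filter
      fun s => ∀ τ ∈ G, s.take τ.length ≠ τ) with _ | s
  · rw [List.head?_eq_none_iff] at hh
    rw [hh] at hmem
    simp at hmem
  · have hs := List.mem_of_mem_head? hh
    rw [List.mem_filter, decide_eq_true_iff, List.mem_map] at hs
    obtain ⟨⟨ρ', hρ', rfl⟩, hs⟩ := hs
    have hl : τ.length ≤ (σ ++ ρ').length := by
      have := length_le_maxLen hτ
      rw [mem_strings] at hρ'
      simp
      omega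
    have he : extend G σ = (σ ++ ρ') ++ [false] := by rw [extend, hh]; rfl
    have hp := hτ' _ hX (by rw [he]; simp at hl ⊢; omega)
    rw [he] at hp
    have hp' := List.prefix_of_prefix_length_le hp (List.prefix_append ..) hl
    exact hs τ hτ (List.prefix_iff_eq_take.1 hp').symm

/-- Initial segments of a real escaping every primitive recursive test. -/
def approx (k : ℕ) : List Bool :=
  k.rec [] fun k σ => extend (enumSeq k (σ.length + 1)) σ

theorem computable_approx : Computable approx := by
  have hG : Computable fun p : ℕ × ℕ × List Bool =>
      (enumSeq p.2.1 (p.2.2.length + 1) : List (List Bool)) :=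
    computable_enumSeq.comp (Computable.fst.comp .snd)
      (Computable.succ.comp (Computable.list_length.comp (Computable.snd.comp .snd)))
  have hstep : Computable fun p : ℕ × ℕ × List Bool =>
      extend (enumSeq p.2.1 (p.2.2.length + 1)) p.2.2 :=
    primrec_extend.to_comp.comp hG (Computable.snd.comp .snd)
  exact Computable.nat_rec (f := id) (g := fun _ => [])
    (h := fun _ p => extend (enumSeq p.1 (p.2.length + 1)) p.2) .id (.const []) hstep.to₂

theorem approx_succ (k : ℕ) :
    approx (k + 1) = extend (enumSeq k ((approx k).length + 1)) (approx k) := rfl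

theorem le_length_approx (k : ℕ) : k ≤ (approx k).length := by
  induction k with
  | zero => simp
  | succ k ih =>
    rw [approx_succ]
    exact Nat.succ_le_of_lt (ih.trans_lt (length_lt_and_prefix_extend _ _).1)

theorem approx_prefix_approx {j k : ℕ} (h : j ≤ k) : approx j <+: approx k := by
  induction k, h using Nat.le_induction with
  | base => exact List.prefix_refl _
  | succ k _ ih => exact ih.trans (approx_succ k ▸ (length_lt_and_prefix_extend _ _).2)

/-- The real with initial segments `approx k`. -/
def limitReal (i : ℕ) : Bool := ((approx (i + 1))[i]?).getD false

theorem take_limitReal (k : ℕ) : take limitReal (approx k).length = approx k := by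
  apply List.ext_getElem
  · simp [take]
  · intro i h₁ h₂
    have h₃ : i < (approx (i + 1)).length := le_length_approx (i + 1)
    simp only [take, List.getElem_map, List.getElem_range, limitReal,
      List.getElem?_eq_getElem h₃, Option.getD_some]
    rcases le_total k (i + 1) with h | h
    · exact ((approx_prefix_approx h).getElem h₂).symm
    · exact (approx_prefix_approx h).getElem h₃

theorem computable_limitReal : Computable limitReal :=
  Primrec.option_getD.to_comp.comp
    (Computable.list_getElem?.comp (computable_approx.comp .succ) .id) (.const false)

theorem stmt6 : ∃ X : ℕ → Bool, Computable X ∧ MLBPRandom X := by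
  refine ⟨limitReal, computable_limitReal, fun G hG => ?_⟩
  obtain ⟨e, rfl⟩ := exists_enumSeq_eq hG.1
  exact ⟨(approx e).length + 1, not_mem_of_take_extend (hG.2 _) (take_limitReal (e + 1))⟩

end BP
end

section
/- Let X be a Martin-Löf BP random real. For any strictly increasing primitive recursive function f : ℕ → ℕ and any real number ε > 0, the inequality |card(X ∩ [[f(n)]])/f(n) − 1/2| ≤ ε holds for infinitely many n. -/
namespace BP



theorem allStrings_succ (L : ℕ) :
    allStrings (L + 1) =
      (allStrings L).map (· ++ [false]) ++ (allStrings L).map (· ++ [true]) := by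
  have hrange : List.range (2 ^ (L + 1)) =
      List.range (2 ^ L) ++ (List.range (2 ^ L)).map (2 ^ L + ·) := by
    rw [pow_succ, mul_two, List.range_add]
  simp only [allStrings, hrange, List.map_append, List.map_map]
  congr 1
  · refine List.map_congr_left fun k hk => ?_
    rw [List.mem_range] at hk
    simp [List.range_succ, Nat.testBit_lt_two_pow hk]
  · refine List.map_congr_left fun k hk => ?_
    rw [List.mem_range] at hk
    simp only [Function.comp_apply, List.range_succ (n := L), List.map_append, List.map_cons,
      List.map_nil, Nat.testBit_two_pow_add_eq, Nat.testBit_lt_two_pow hk, Bool.not_false]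
    congr 1
    refine List.map_congr_left fun i hi => ?_
    exact Nat.testBit_two_pow_add_gt (List.mem_range.1 hi) k

theorem primrec_allStrings : Primrec allStrings := by
  have happend (b : Bool) : Primrec fun l : List (List Bool) => l.map (· ++ [b]) :=
    Primrec.list_map .id (Primrec.list_concat.comp .snd (.const b))
  have hstep : Primrec₂ fun (_ : ℕ) (l : List (List Bool)) =>
      l.map (· ++ [false]) ++ l.map (· ++ [true]) :=
    Primrec.list_append.comp ((happend false).comp .snd) ((happend true).comp .snd)
  refine (Primrec.nat_rec₁ (allStrings 0) hstep).of_eq fun L => ?_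
  induction L with
  | zero => rfl
  | succ L ih => rw [allStrings_succ, ← ih]

theorem length_of_mem_allStrings {L : ℕ} {σ : List Bool} (h : σ ∈ allStrings L) :
    σ.length = L := by
  obtain ⟨k, -, rfl⟩ := List.mem_map.1 h
  simp

theorem take_mem_allStrings (X : ℕ → Bool) (L : ℕ) : take X L ∈ allStrings L := by
  induction L with
  | zero => simp [take, allStrings]
  | succ L ih =>
    have h : take X (L + 1) = take X L ++ [X L] := by simp [take, List.range_succ]
    rw [allStrings_succ, h]
    cases X L <;> simp [ih]

/-- The second moment of the fair random walk of length `L`. -/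
theorem sum_sq_allStrings (L : ℕ) :
    ((allStrings L).map fun σ => (2 * (σ.countP id : ℚ) - L) ^ 2).sum = (L : ℚ) * 2 ^ L := by
  have hlength (L : ℕ) : (allStrings L).length = 2 ^ L := by simp [allStrings]
  have hsum (l : List (List Bool)) (L : ℚ) :
      (l.map fun σ => (2 * ((σ ++ [false]).countP id : ℚ) - (L + 1)) ^ 2).sum +
        (l.map fun σ => (2 * ((σ ++ [true]).countP id : ℚ) - (L + 1)) ^ 2).sum =
      2 * (l.map fun σ => (2 * (σ.countP id : ℚ) - L) ^ 2).sum + 2 * (l.length : ℚ) := by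
    induction l with
    | nil => simp
    | cons σ l ih =>
      simp only [List.map_cons, List.sum_cons, List.length_cons]
      simp only [List.countP_append, List.countP_singleton, id, Bool.false_eq_true, if_true,
        if_false] at ih ⊢
      push_cast at ih ⊢
      linear_combination ih
  induction L with
  | zero => simp [allStrings]
  | succ L ih =>
    rw [allStrings_succ, List.map_append, List.sum_append, List.map_map, List.map_map]
    simp only [Function.comp_def, Nat.cast_succ]
    rw [hsum, ih, hlength]
    push_cast
    ring

theorem length_filter_mul_le_sum_map {α : Type*} (l : List α) (p : α → Bool) (g : α → ℚ) (c : ℚ)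
    (hg : ∀ a, 0 ≤ g a) (hp : ∀ a ∈ l, p a = true → c ≤ g a) :
    ((l.filter p).length : ℚ) * c ≤ (l.map g).sum := by
  induction l with
  | nil => simp
  | cons a l ih =>
    have ih := ih fun b hb => hp b (List.mem_cons_of_mem a hb)
    have ha := hp a List.mem_cons_self
    have hga := hg a
    by_cases h : p a = true
    · have := ha h
      simp only [List.filter_cons, h, if_true, List.length_cons, List.map_cons, List.sum_cons]
      push_cast
      linarith
    · simp only [List.filter_cons, h, List.map_cons, List.sum_cons]
      simp only [Bool.false_eq_true, if_false]
      linarith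

theorem maxLen_eq {G : List (List Bool)} {L : ℕ} (hG : G ≠ []) (h : ∀ σ ∈ G, σ.length = L) :
    maxLen G = L := by
  induction G with
  | nil => exact absurd rfl hG
  | cons σ G ih =>
    have hσ := h σ List.mem_cons_self
    rcases eq_or_ne G [] with rfl | hne
    · simp [maxLen, hσ]
    · have := ih hne fun τ hτ => h τ (List.mem_cons_of_mem σ hτ)
      simp only [maxLen, List.map_cons, List.foldr_cons] at this ⊢
      rw [this, hσ, max_self]

theorem mu_filter_allStrings (L : ℕ) (p : List Bool → Bool) :
    mu ((allStrings L).filter p) = (((allStrings L).filter p).length : ℚ) / 2 ^ L := by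
  rcases eq_or_ne ((allStrings L).filter p) [] with h | h
  · simp [h, mu]
  · rw [mu, maxLen_eq h fun σ hσ => length_of_mem_allStrings (List.mem_filter.1 hσ).1]
    congr 3
    refine List.filter_congr fun σ hσ => ?_
    rw [Bool.eq_iff_iff]
    simp only [List.any_eq_true, List.mem_filter, decide_eq_true_eq]
    constructor
    · rintro ⟨τ, ⟨hτ, hpτ⟩, hle⟩
      have : τ = σ := hle.eq_of_length
        ((length_of_mem_allStrings hτ).trans (length_of_mem_allStrings hσ).symm)
      rwa [← this]
    · exact fun hpσ => ⟨σ, ⟨hσ, hpσ⟩, List.prefix_rfl⟩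

/-- The numbers of ones and zeros in `σ` differ by more than `σ.length / k`. The sum of the two
truncated differences is the absolute value of `2 * σ.countP id - σ.length`. -/
def Deviates (k : ℕ) (σ : List Bool) : Prop :=
  σ.length < k * ((2 * σ.countP id - σ.length) + (σ.length - 2 * σ.countP id))

instance (k : ℕ) : DecidablePred (Deviates k) := fun _ => Nat.decLt _ _

theorem deviates_iff {k : ℕ} {σ : List Bool} :
    Deviates k σ ↔ (σ.length : ℝ) < k * |2 * (σ.countP id : ℝ) - σ.length| := by
  have h : (((2 * σ.countP id - σ.length) + (σ.length - 2 * σ.countP id) : ℕ) : ℝ) =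
      |2 * (σ.countP id : ℝ) - σ.length| := by
    rcases le_total (2 * σ.countP id) σ.length with h | h
    · have h' : (2 * σ.countP id : ℝ) ≤ σ.length := by exact_mod_cast h
      rw [Nat.sub_eq_zero_of_le h, zero_add, abs_of_nonpos (by linarith)]
      push_cast [h]
      ring
    · have h' : (σ.length : ℝ) ≤ 2 * σ.countP id := by exact_mod_cast h
      rw [Nat.sub_eq_zero_of_le h, add_zero, abs_of_nonneg (by linarith)]
      push_cast [h]
      ring
  rw [Deviates, ← h]
  exact_mod_cast Iff.rfl

theorem primrecPred_deviates (k : ℕ) : PrimrecPred (Deviates k) := by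
  have hcount : Primrec fun σ : List Bool => σ.countP id := by
    have hp : PrimrecPred fun b : Bool => b = true := Primrec.eq.comp .id (.const true)
    exact (Primrec.list_length.comp (Primrec.listFilter hp)).of_eq fun σ => by
      simp [List.countP_eq_length_filter]; rfl
  have hdouble := Primrec.nat_mul.comp (.const 2) hcount
  exact Primrec.nat_lt.comp .list_length (Primrec.nat_mul.comp (.const k)
    (Primrec.nat_add.comp (Primrec.nat_sub.comp hdouble .list_length)
      (Primrec.nat_sub.comp .list_length hdouble)))

/-- Chebyshev's inequality for the fair random walk of length `L`. -/
theorem mu_deviates_le (k : ℕ) {L : ℕ} (hL : 0 < L) :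
    mu ((allStrings L).filter (Deviates k ·)) ≤ (k : ℚ) ^ 2 / L := by
  have hL' : (0 : ℚ) < L := by exact_mod_cast hL
  have hle := length_filter_mul_le_sum_map (allStrings L) (Deviates k ·)
    (fun σ => (k : ℚ) ^ 2 * (2 * (σ.countP id : ℚ) - L) ^ 2) ((L : ℚ) ^ 2)
    (fun _ => by positivity) (fun σ hσ hdev => by
      have h := deviates_iff.1 (of_decide_eq_true hdev)
      rw [length_of_mem_allStrings hσ] at h
      have h' : (L : ℚ) < k * |2 * (σ.countP id : ℚ) - L| := by exact_mod_cast h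
      calc (L : ℚ) ^ 2 ≤ (k * |2 * (σ.countP id : ℚ) - L|) ^ 2 := by gcongr
        _ = _ := by rw [mul_pow, sq_abs])
  rw [List.sum_map_mul_left, sum_sq_allStrings] at hle
  rw [mu_filter_allStrings, div_le_div_iff₀ (by positivity) hL']
  refine le_of_mul_le_mul_right ?_ hL'
  linarith

theorem length_take (X : ℕ → Bool) (L : ℕ) : (take X L).length = L := by simp [take]

theorem countP_take (X : ℕ → Bool) (L : ℕ) : (take X L).countP id = cardBelow X L := by
  simp [take, cardBelow, List.countP_map]

theorem deviates_take {X : ℕ → Bool} {k L : ℕ} {ε : ℝ} (hL : 0 < L) (hk : 1 ≤ 2 * ε * k)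
    (h : ε < |(cardBelow X L : ℝ) / L - 1 / 2|) : Deviates k (take X L) := by
  have hL' : (0 : ℝ) < L := by exact_mod_cast hL
  rw [deviates_iff, length_take, countP_take]
  have hk' : (0 : ℝ) < k := by
    rcases Nat.eq_zero_or_pos k with rfl | hpos
    · norm_num at hk
    · exact_mod_cast hpos
  have heq : |2 * (cardBelow X L : ℝ) - L| = 2 * L * |(cardBelow X L : ℝ) / L - 1 / 2| := by
    rw [show 2 * (cardBelow X L : ℝ) - L = 2 * L * ((cardBelow X L : ℝ) / L - 1 / 2) by field_simp,
      abs_mul, abs_of_pos (by positivity)]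
  rw [heq]
  calc (L : ℝ) ≤ L * (2 * ε * k) := le_mul_of_one_le_right hL'.le hk
    _ = k * (2 * L * ε) := by ring
    _ < _ := by gcongr

theorem primrec_two_pow : Primrec fun n : ℕ => 2 ^ n :=
  Primrec.nat_iff.2 (Nat.Primrec.pow.comp ((Nat.Primrec.const 2).pair .id)) |>.of_eq fun n => by simp

theorem stmt9 (X : ℕ → Bool) (hX : MLBPRandom X) (f : ℕ → ℕ)
    (hf : Primrec f) (hmono : StrictMono f) (ε : ℝ) (hε : 0 < ε) :
    ∀ N, ∃ n ≥ N, |(cardBelow X (f n) : ℝ) / (f n : ℝ) - 1 / 2| ≤ ε := by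
  intro N
  by_contra! hN
  obtain ⟨k, hk⟩ := exists_nat_ge (1 / (2 * ε))
  have hk' : 1 ≤ 2 * ε * k := by rwa [div_le_iff₀' (by positivity)] at hk
  have hkpos : 0 < k := by
    rcases Nat.eq_zero_or_pos k with rfl | hpos
    · norm_num at hk'
    · exact hpos
  let index (n : ℕ) : ℕ := N + k ^ 2 * 2 ^ n
  have hindex (n : ℕ) : k ^ 2 * 2 ^ n ≤ f (index n) :=
    (Nat.le_add_left _ _).trans hmono.le_apply
  have hpos (n : ℕ) : 0 < f (index n) := lt_of_lt_of_le (by positivity) (hindex n)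
  have hprim : Primrec index :=
    Primrec.nat_add.comp (.const N) (Primrec.nat_mul.comp (.const (k ^ 2)) primrec_two_pow)
  obtain ⟨n, hn⟩ := hX (fun n => (allStrings (f (index n))).filter (Deviates k ·))
    ⟨(Primrec.listFilter (primrecPred_deviates k)).comp
      (primrec_allStrings.comp (hf.comp hprim)), fun n => by
      refine (mu_deviates_le k (hpos n)).trans ?_
      have h : (k : ℚ) ^ 2 * 2 ^ n ≤ f (index n) := by exact_mod_cast hindex n
      have hfpos : (0 : ℚ) < f (index n) := by exact_mod_cast hpos n
      rwa [div_le_iff₀ hfpos, inv_mul_eq_div, le_div_iff₀ (by positivity)]⟩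
  refine hn ⟨take X (f (index n)), List.mem_filter.2 ⟨take_mem_allStrings X _, ?_⟩, ?_⟩
  · exact decide_eq_true
      (deviates_take (hpos n) hk' (hN (index n) (Nat.le_add_right _ _)))
  · rw [length_take]

end BP
end
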